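/- Canonical run modification: For each edge h ∈ E, each run r = ⟨X^e, {f^e_u}_{u∈Inc(e)}⟩_{e∈E} of the canonical protocol 𝒫^δ_E, and each maximal consistent set M ⊆ Φ(Σ) such that X^h = M ∩ Φ(Σ,{h}), there is a run r̂ = ⟨X̂^e, {f̂^e_u}_{u∈Inc(e)}⟩_{e∈E} of 𝒫^δ_E such that (1) X̂^e = M ∩ Φ(Σ,{e}) for each e ∈ E, and (2) r̂ =_h r (i.e., r̂ and r assign the same value to the edge h). -/

import Mathlib

/- Formulas of the language Φ(Σ): atoms are indexed by a type `P` of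
propositional symbols; `edgeOf p` is the unique edge `e` with `p ∈ P_e`
(this encodes a pairwise disjoint family `{P_e}_{e ∈ E}`). -/
inductive Form (E P : Type) : Type
  | bot : Form E P
  | atom : P → Form E P
  | imp : Form E P → Form E P → Form E P
  | box : E → Form E P → Form E P

namespace Form
/-- ¬φ abbreviates φ → ⊥. -/
def neg {E P : Type} (φ : Form E P) : Form E P := imp φ bot
/-- φ ∨ ψ abbreviates ¬φ → ψ. -/
def or {E P : Type} (φ ψ : Form E P) : Form E P := imp (neg φ) ψ
end Form

/-- An undirected multigraph is given by `inc : E → V × V` sending each edge to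
its (two, possibly equal) ends.  `Incident inc e v` says `v` is an end of `e`. -/
def Incident {V E : Type} (inc : E → V × V) (e : E) (v : V) : Prop :=
  (inc e).1 = v ∨ (inc e).2 = v

/-- Adjacency using only edges from the set `S`. -/
def AdjVia {V E : Type} (inc : E → V × V) (S : Set E) (u v : V) : Prop :=
  ∃ e ∈ S, inc e = (u, v) ∨ inc e = (v, u)

/-- Reachability using only edges from the set `S`. -/
def ReachableVia {V E : Type} (inc : E → V × V) (S : Set E) : V → V → Prop :=
  Relation.ReflTransGen (AdjVia inc S)

/-- The graph is connected. -/
def ConnectedGraph {V E : Type} (inc : E → V × V) : Prop :=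
  ∀ u v : V, ReachableVia inc Set.univ u v

/-- A path `e₀, v₁, e₁, …, v_k, e_k`: distinct edges, distinct vertices, with
`e_i, e_{i+1}` incident to `v_{i+1}` for `0 ≤ i < k`. -/
structure GPath (V E : Type) (inc : E → V × V) where
  edges : List E
  verts : List V
  len_eq : edges.length = verts.length + 1
  edges_nodup : edges.Nodup
  verts_nodup : verts.Nodup
  incid_left : ∀ i (hi : i < verts.length),
    Incident inc (edges.get ⟨i, by omega⟩) (verts.get ⟨i, hi⟩)
  incid_right : ∀ i (hi : i < verts.length),
    Incident inc (edges.get ⟨i + 1, by omega⟩) (verts.get ⟨i, hi⟩)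

/-- `g` is a gateway between `A` and `B`: every path that starts with an edge
in `A` and ends with an edge in `B` contains the edge `g`. -/
def IsGateway {V E : Type} (inc : E → V × V) (A B : Set E) (g : E) : Prop :=
  ∀ p : GPath V E inc, ∀ hne : p.edges ≠ [],
    p.edges.head hne ∈ A → p.edges.getLast hne ∈ B → g ∈ p.edges

/-- The sublanguage Φ(Σ,T). -/
inductive InLang {E P : Type} (edgeOf : P → E) (T : Set E) : Form E P → Prop
  | bot : InLang edgeOf T Form.bot
  | atom (p : P) : edgeOf p ∈ T → InLang edgeOf T (Form.atom p)
  | imp {φ ψ : Form E P} : InLang edgeOf T φ → InLang edgeOf T ψ →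
      InLang edgeOf T (Form.imp φ ψ)
  | box (t : E) (φ : Form E P) : t ∈ T → InLang edgeOf T (Form.box t φ)

/-- Evaluation of a formula under a truth assignment `v` that treats atoms and
boxed formulas as atomic. -/
def evalWith {E P : Type} (v : Form E P → Prop) : Form E P → Prop
  | Form.bot => False
  | Form.imp φ ψ => evalWith v φ → evalWith v ψ
  | φ => v φ

/-- Propositional tautology. -/
def Tautology {E P : Type} (φ : Form E P) : Prop := ∀ v, evalWith v φ

/-- The proof system: propositional tautologies, Truth, Positive Introspection,
Negative Introspection, Distributivity, Gateway; Modus Ponens, Necessitation. -/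
inductive Deriv {V E P : Type} (inc : E → V × V) (edgeOf : P → E) : Form E P → Prop
  | taut {φ : Form E P} : Tautology φ → Deriv inc edgeOf φ
  | truth (e : E) (φ : Form E P) : Deriv inc edgeOf (Form.imp (Form.box e φ) φ)
  | posIntro (e : E) (φ : Form E P) :
      Deriv inc edgeOf (Form.imp (Form.box e φ) (Form.box e (Form.box e φ)))
  | negIntro (e : E) (φ : Form E P) :
      Deriv inc edgeOf (Form.imp (Form.neg (Form.box e φ)) (Form.box e (Form.neg (Form.box e φ))))
  | distrib (e : E) (φ ψ : Form E P) :
      Deriv inc edgeOf (Form.imp (Form.box e (Form.imp φ ψ))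
        (Form.imp (Form.box e φ) (Form.box e ψ)))
  | gateway {A B : Set E} {g e : E} {φ ψ : Form E P} :
      IsGateway inc A B g → e ∈ A → InLang edgeOf A φ → InLang edgeOf B ψ →
      Deriv inc edgeOf (Form.imp (Form.box e (Form.imp φ ψ)) (Form.imp φ (Form.box g ψ)))
  | mp {φ ψ : Form E P} : Deriv inc edgeOf (Form.imp φ ψ) → Deriv inc edgeOf φ →
      Deriv inc edgeOf ψ
  | nec (e : E) {φ : Form E P} : Deriv inc edgeOf φ → Deriv inc edgeOf (Form.box e φ)

/-- `X ⊢ φ`: derivable from assumptions `X` using theorems of the system and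
Modus Ponens only. -/
inductive DerivFrom {V E P : Type} (inc : E → V × V) (edgeOf : P → E)
    (X : Set (Form E P)) : Form E P → Prop
  | ax {φ : Form E P} : Deriv inc edgeOf φ → DerivFrom inc edgeOf X φ
  | hyp {φ : Form E P} : φ ∈ X → DerivFrom inc edgeOf X φ
  | mp {φ ψ : Form E P} : DerivFrom inc edgeOf X (Form.imp φ ψ) →
      DerivFrom inc edgeOf X φ → DerivFrom inc edgeOf X ψ

/-- A protocol over the signature: a set of values `W e` for each channel `e`,
local conditions `L v` at each vertex, and a valuation `π`. -/
structure Protocol {V E P : Type} (inc : E → V × V) (edgeOf : P → E) where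
  W : E → Type
  L : (v : V) → Set ((e : {e : E // Incident inc e v}) → W e.1)
  pi : (p : P) → Set (W (edgeOf p))

/-- A run of a protocol. -/
def IsRun {V E P : Type} {inc : E → V × V} {edgeOf : P → E}
    (Pr : Protocol inc edgeOf) (r : (e : E) → Pr.W e) : Prop :=
  ∀ v : V, (fun e : {e : E // Incident inc e v} => r e.1) ∈ Pr.L v

def Run {V E P : Type} {inc : E → V × V} {edgeOf : P → E}
    (Pr : Protocol inc edgeOf) : Type :=
  {r : (e : E) → Pr.W e // IsRun Pr r}

/-- Satisfaction `r ⊩ φ`. -/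
def Sat {V E P : Type} {inc : E → V × V} {edgeOf : P → E}
    (Pr : Protocol inc edgeOf) : Run Pr → Form E P → Prop
  | _, Form.bot => False
  | r, Form.atom p => r.1 (edgeOf p) ∈ Pr.pi p
  | r, Form.imp φ ψ => Sat Pr r φ → Sat Pr r ψ
  | r, Form.box e φ => ∀ r' : Run Pr, r'.1 e = r.1 e → Sat Pr r' φ
/-- Big disjunction of a list of formulas. -/
def bigDisj {E P : Type} : List (Form E P) → Form E P
  | [] => Form.bot
  | φ :: l => Form.or φ (bigDisj l)

/-- The disjunction ⋁_{e ∈ s} δ_e. -/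
noncomputable def disjOver {E P : Type} (s : Finset E) (d : E → Form E P) : Form E P :=
  bigDisj (s.toList.map d)

/-- The formula δ = ⋁_{e ∈ E} δ_e. -/
noncomputable def deltaForm {E P : Type} [Fintype E] (d : E → Form E P) : Form E P :=
  disjOver Finset.univ d

/-- ⋁_{h ∈ S} δ_h for a set of edges `S`. -/
noncomputable def disjSet {E P : Type} [Fintype E] (d : E → Form E P) (S : Set E) : Form E P :=
  disjOver (Set.toFinite S).toFinset d

/-- `e` is a bridge: removing it disconnects the graph. -/
def IsBridge {V E : Type} (inc : E → V × V) (e : E) : Prop :=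
  ¬ ∀ u v : V, ReachableVia inc {x | x ≠ e} u v

/-- Edges of the connected component `C^u_{-e}` of the graph with `e` deleted
that contains the vertex `u`. -/
def compEdges {V E : Type} (inc : E → V × V) (e : E) (u : V) : Set E :=
  {h | h ≠ e ∧ ∃ w : V, Incident inc h w ∧ ReachableVia inc {x | x ≠ e} u w}

/-- `X` is consistent. -/
def ConsistentSet {V E P : Type} (inc : E → V × V) (edgeOf : P → E)
    (X : Set (Form E P)) : Prop :=
  ¬ DerivFrom inc edgeOf X Form.bot

/-- `X` is a maximal consistent subset of Φ(Σ,T). -/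
def MaxConsistentIn {V E P : Type} (inc : E → V × V) (edgeOf : P → E)
    (T : Set E) (X : Set (Form E P)) : Prop :=
  (∀ φ ∈ X, InLang edgeOf T φ) ∧ ConsistentSet inc edgeOf X ∧
    ∀ φ : Form E P, InLang edgeOf T φ → φ ∉ X →
      ¬ ConsistentSet inc edgeOf (insert φ X)

/-- `X` is a maximal consistent subset of Φ(Σ). -/
def MaxConsistent {V E P : Type} (inc : E → V × V) (edgeOf : P → E)
    (X : Set (Form E P)) : Prop :=
  ConsistentSet inc edgeOf X ∧
    ∀ φ : Form E P, φ ∉ X → ¬ ConsistentSet inc edgeOf (insert φ X)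

/-- A value of an edge under a canonical protocol 𝒫^δ_F: a set of formulas `X`
together with flow values `f₁`, `f₂` at the two ends `(inc e).1`, `(inc e).2`. -/
structure CanValue (E P : Type) where
  X : Set (Form E P)
  f₁ : ℝ
  f₂ : ℝ

/-- The defining conditions on a value of edge `e` under the canonical
protocol 𝒫^δ_F, where δ = ⋁_{e ∈ E} d e. -/
def IsCanValue {V E P : Type} [Fintype E] (inc : E → V × V) (edgeOf : P → E)
    (d : E → Form E P) (F : Set E) (e : E) (w : CanValue E P) : Prop :=
  MaxConsistentIn inc edgeOf {e} w.X ∧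
  (w.f₁ + w.f₂ > 0 ↔ d e ∈ w.X) ∧
  (IsBridge inc e → d e ∉ w.X → w.f₁ + w.f₂ = 0) ∧
  (IsBridge inc e → w.f₁ < 0 →
    Form.box e (disjSet d (compEdges inc e (inc e).1)) ∈ w.X) ∧
  (IsBridge inc e → w.f₂ < 0 →
    Form.box e (disjSet d (compEdges inc e (inc e).2)) ∈ w.X) ∧
  (IsBridge inc e → e ∈ F → Form.box e (deltaForm d) ∈ w.X → d e ∉ w.X →
    w.f₁ < 0 ∨ w.f₂ < 0) ∧
  (¬ IsBridge inc e → w.f₁ + w.f₂ < 0 → Form.box e (deltaForm d) ∈ w.X) ∧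
  (¬ IsBridge inc e → e ∈ F → Form.box e (deltaForm d) ∈ w.X → d e ∉ w.X →
    w.f₁ + w.f₂ < 0)

open Classical in
/-- The flow value `f^e_u` of edge `e` at vertex `u` (0 if `u` is not an end
of `e`; for a loop both ends contribute). -/
noncomputable def flowAt {V E P : Type} (inc : E → V × V) (w : CanValue E P)
    (e : E) (u : V) : ℝ :=
  (if (inc e).1 = u then w.f₁ else 0) + (if (inc e).2 = u then w.f₂ else 0)

/-- The local condition of the canonical protocol at a vertex `u`:
if δ_e ∉ X^e for every edge `e` incident to `u`, then Σ_{e ∈ Inc(u)} f^e_u ≥ 0. -/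
def CanLocal {V E P : Type} [Fintype E] (inc : E → V × V) (d : E → Form E P)
    (r : (e : E) → CanValue E P) (u : V) : Prop :=
  (∀ e : E, Incident inc e u → d e ∉ (r e).X) → 0 ≤ ∑ e : E, flowAt inc (r e) e u

/-- `r` is a run of the canonical protocol 𝒫^δ_F. -/
def IsCanRun {V E P : Type} [Fintype E] (inc : E → V × V) (edgeOf : P → E)
    (d : E → Form E P) (F : Set E) (r : (e : E) → CanValue E P) : Prop :=
  (∀ e : E, IsCanValue inc edgeOf d F e (r e)) ∧ ∀ u : V, CanLocal inc d r u

/-- The set Γ_M of paths (Definition of Γ_M). -/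
def InGamma {V E P : Type} [Fintype E] (inc : E → V × V) (d : E → Form E P)
    (M : Set (Form E P)) (p : GPath V E inc) : Prop :=
  0 < p.verts.length ∧
  (∀ h0 : 0 < p.verts.length,
    Form.box (p.edges.get ⟨0, by have := p.len_eq; omega⟩)
      (disjSet d (compEdges inc (p.edges.get ⟨0, by have := p.len_eq; omega⟩)
        (p.verts.get ⟨0, h0⟩))) ∈ M) ∧
  (∀ i (hi : i < p.verts.length),
    d (p.edges.get ⟨i, by have := p.len_eq; omega⟩) ∉ M) ∧
  (∀ i (hi : i < p.verts.length),
    IsBridge inc (p.edges.get ⟨i, by have := p.len_eq; omega⟩) →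
    Form.box (p.edges.get ⟨i, by have := p.len_eq; omega⟩)
      (disjSet d (compEdges inc (p.edges.get ⟨i, by have := p.len_eq; omega⟩)
        (p.verts.get ⟨i, hi⟩))) ∈ M) ∧
  (∀ hne : p.edges ≠ [], d (p.edges.getLast hne) ∈ M)


section Logic

variable {V E P : Type} {inc : E → V × V} {edgeOf : P → E}

theorem evalWith_neg (v : Form E P → Prop) (φ : Form E P) :
    evalWith v φ.neg ↔ ¬ evalWith v φ := Iff.rfl

theorem evalWith_bigDisj (v : Form E P → Prop) (l : List (Form E P)) :
    evalWith v (bigDisj l) ↔ ∃ φ ∈ l, evalWith v φ := by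
  induction l with
  | nil => simp [bigDisj, evalWith]
  | cons φ l ih =>
    have : evalWith v (bigDisj (φ :: l)) ↔ (¬ evalWith v φ → evalWith v (bigDisj l)) := Iff.rfl
    rw [this, ih]
    simp only [List.mem_cons, exists_eq_or_imp]
    tauto

theorem inLang_bigDisj {T : Set E} {l : List (Form E P)} (hl : ∀ φ ∈ l, InLang edgeOf T φ) :
    InLang edgeOf T (bigDisj l) := by
  induction l with
  | nil => exact InLang.bot
  | cons φ l ih =>
    simp only [List.mem_cons, forall_eq_or_imp] at hl
    exact InLang.imp (InLang.imp hl.1 InLang.bot) (ih hl.2)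

theorem InLang.mono {S T : Set E} (hST : S ⊆ T) {φ : Form E P} (hφ : InLang edgeOf S φ) :
    InLang edgeOf T φ := by
  induction hφ with
  | bot => exact .bot
  | atom p hp => exact .atom p (hST hp)
  | imp _ _ h₁ h₂ => exact .imp h₁ h₂
  | box t φ ht => exact .box t φ (hST ht)

theorem Deriv.trans {φ ψ χ : Form E P} (h₁ : Deriv inc edgeOf (φ.imp ψ))
    (h₂ : Deriv inc edgeOf (ψ.imp χ)) : Deriv inc edgeOf (φ.imp χ) := by
  refine .mp (.mp (.taut ?_) h₁) h₂
  intro v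
  simp only [evalWith]
  tauto

theorem Deriv.box_mono (e : E) {φ ψ : Form E P} (h : Deriv inc edgeOf (φ.imp ψ)) :
    Deriv inc edgeOf ((Form.box e φ).imp (Form.box e ψ)) :=
  .mp (.distrib e φ ψ) (.nec e h)

theorem DerivFrom.mono {X Y : Set (Form E P)} (hXY : X ⊆ Y) {φ : Form E P}
    (h : DerivFrom inc edgeOf X φ) : DerivFrom inc edgeOf Y φ := by
  induction h with
  | ax h => exact .ax h
  | hyp h => exact .hyp (hXY h)
  | mp _ _ h₁ h₂ => exact .mp h₁ h₂

theorem DerivFrom.deduction {X : Set (Form E P)} {φ ψ : Form E P}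
    (h : DerivFrom inc edgeOf (insert φ X) ψ) : DerivFrom inc edgeOf X (φ.imp ψ) := by
  have weaken : ∀ χ : Form E P, Deriv inc edgeOf (χ.imp (φ.imp χ)) := fun χ =>
    .taut fun v => by simp only [evalWith]; tauto
  induction h with
  | ax h => exact .mp (.ax (weaken _)) (.ax h)
  | @hyp χ h =>
    rcases h with rfl | h
    · exact .ax (.taut fun v => by simp only [evalWith]; tauto)
    · exact .mp (.ax (weaken _)) (.hyp h)
  | @mp α β _ _ h₁ h₂ =>
    refine .mp (.mp (.ax (.taut (φ := (φ.imp (α.imp β)).imp ((φ.imp α).imp (φ.imp β))) ?_)) h₁) h₂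
    intro v
    simp only [evalWith]
    tauto

namespace MaxConsistent

variable {M : Set (Form E P)}

theorem neg_derivFrom (hM : MaxConsistent inc edgeOf M) {φ : Form E P} (hφ : φ ∉ M) :
    DerivFrom inc edgeOf M φ.neg :=
  DerivFrom.deduction (not_not.1 (hM.2 φ hφ))

theorem mem_of_derivFrom (hM : MaxConsistent inc edgeOf M) {φ : Form E P}
    (h : DerivFrom inc edgeOf M φ) : φ ∈ M := by
  by_contra hφ
  exact hM.1 (.mp (hM.neg_derivFrom hφ) h)

theorem mem_of_deriv_imp (hM : MaxConsistent inc edgeOf M) {φ ψ : Form E P}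
    (h : Deriv inc edgeOf (φ.imp ψ)) (hφ : φ ∈ M) : ψ ∈ M :=
  hM.mem_of_derivFrom (.mp (.ax h) (.hyp hφ))

theorem exists_mem_of_bigDisj (hM : MaxConsistent inc edgeOf M) {l : List (Form E P)}
    (h : bigDisj l ∈ M) : ∃ φ ∈ l, φ ∈ M := by
  induction l with
  | nil => exact (hM.1 (.hyp h)).elim
  | cons φ l ih =>
    by_cases hφ : φ ∈ M
    · exact ⟨φ, by simp, hφ⟩
    · obtain ⟨ψ, hψ, hψM⟩ :=
        ih (hM.mem_of_derivFrom (.mp (.hyp h) (hM.neg_derivFrom hφ)))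
      exact ⟨ψ, by simp [hψ], hψM⟩

theorem inter_inLang (hM : MaxConsistent inc edgeOf M) (T : Set E) :
    MaxConsistentIn inc edgeOf T (M ∩ {φ | InLang edgeOf T φ}) := by
  refine ⟨fun φ hφ => hφ.2, fun h => hM.1 (h.mono Set.inter_subset_left), ?_⟩
  intro φ hφ hφM hcon
  have hneg : φ.neg ∈ M :=
    hM.mem_of_derivFrom (hM.neg_derivFrom fun h => hφM ⟨h, hφ⟩)
  exact hcon (.mp (.hyp (Set.mem_insert_of_mem _ ⟨hneg, .imp hφ .bot⟩))
    (.hyp (Set.mem_insert _ _)))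

end MaxConsistent

theorem evalWith_disjSet [Fintype E] (v : Form E P → Prop) (d : E → Form E P) (S : Set E) :
    evalWith v (disjSet d S) ↔ ∃ e ∈ S, evalWith v (d e) := by
  simp [disjSet, disjOver, evalWith_bigDisj]

theorem inLang_disjSet [Fintype E] {d : E → Form E P} (hd : ∀ e, InLang edgeOf {e} (d e))
    (S : Set E) : InLang edgeOf S (disjSet d S) := by
  refine inLang_bigDisj fun φ hφ => ?_
  simp only [List.mem_map, Finset.mem_toList, Set.Finite.mem_toFinset] at hφ
  obtain ⟨e, he, rfl⟩ := hφ
  exact (hd e).mono (by simpa using he)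

theorem disjSet_univ [Fintype E] (d : E → Form E P) : disjSet d Set.univ = deltaForm d := by
  simp [disjSet, deltaForm]

theorem Deriv.box_disjSet_mono [Fintype E] (d : E → Form E P) (e : E) {S T : Set E}
    (hST : S ⊆ T) :
    Deriv inc edgeOf ((Form.box e (disjSet d S)).imp (Form.box e (disjSet d T))) := by
  refine .box_mono e (.taut fun v => ?_)
  simp only [evalWith, evalWith_disjSet]
  exact fun ⟨t, ht, h⟩ => ⟨t, hST ht, h⟩

end Logic

section Graph

variable {V E P : Type} {inc : E → V × V} {edgeOf : P → E}

theorem AdjVia.symm {S : Set E} {u v : V} (h : AdjVia inc S u v) : AdjVia inc S v u := by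
  obtain ⟨e, he, h⟩ := h
  exact ⟨e, he, h.symm⟩

theorem ReachableVia.symm {S : Set E} {u v : V} (h : ReachableVia inc S u v) :
    ReachableVia inc S v u := by
  induction h with
  | refl => exact .refl
  | tail _ h ih => exact .head h.symm ih

/-- One of the two ends of an edge. -/
def endOf (inc : E → V × V) (e : E) (b : Bool) : V := cond b (inc e).1 (inc e).2

theorem incident_iff_endOf {e : E} {v : V} : Incident inc e v ↔ ∃ b, endOf inc e b = v := by
  simp [Incident, endOf, or_comm]

theorem incident_endOf (e : E) (b : Bool) : Incident inc e (endOf inc e b) :=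
  incident_iff_endOf.2 ⟨b, rfl⟩

theorem adjVia_iff_endOf {S : Set E} {u v : V} :
    AdjVia inc S u v ↔ ∃ e ∈ S, ∃ b, endOf inc e b = u ∧ endOf inc e (!b) = v := by
  simp [AdjVia, endOf, Prod.ext_iff, or_comm, and_comm]

theorem not_isBridge_of_reachable (hconn : ConnectedGraph inc) {e : E} (b : Bool)
    (h : ReachableVia inc {x | x ≠ e} (endOf inc e b) (endOf inc e (!b))) : ¬ IsBridge inc e := by
  refine not_not.2 fun u v => ?_
  induction hconn u v with
  | refl => exact .refl
  | @tail x y _ hxy ih =>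
    obtain ⟨f, -, c, rfl, rfl⟩ := adjVia_iff_endOf.1 hxy
    by_cases hf : f = e
    · subst hf
      refine ih.trans ?_
      by_cases hc : c = b
      · exact hc ▸ h
      · obtain rfl : c = !b := by cases b <;> cases c <;> simp_all
        rw [Bool.not_not]
        exact h.symm
    · exact ih.tail (adjVia_iff_endOf.2 ⟨f, hf, c, rfl, rfl⟩)

theorem reachable_end_of_isBridge (hconn : ConnectedGraph inc) (e : E) (v : V) :
    ∃ b, ReachableVia inc {x | x ≠ e} (endOf inc e b) v := by
  induction hconn (endOf inc e true) v with
  | refl => exact ⟨true, .refl⟩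
  | @tail x y _ hxy ih =>
    obtain ⟨b, hb⟩ := ih
    obtain ⟨f, -, c, rfl, rfl⟩ := adjVia_iff_endOf.1 hxy
    by_cases hf : f = e
    · exact ⟨!c, hf ▸ .refl⟩
    · exact ⟨b, hb.tail (adjVia_iff_endOf.2 ⟨f, hf, c, rfl, rfl⟩)⟩

theorem reachable_of_mem_compEdges {g f : E} {u v : V} (hf : f ∈ compEdges inc g u)
    (hfv : Incident inc f v) : ReachableVia inc {x | x ≠ g} u v := by
  obtain ⟨hfg, w, hfw, hw⟩ := hf
  refine hw.trans ?_
  obtain ⟨b, rfl⟩ := incident_iff_endOf.1 hfw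
  obtain ⟨c, rfl⟩ := incident_iff_endOf.1 hfv
  by_cases hc : c = b
  · exact hc ▸ .refl
  · obtain rfl : c = !b := by cases b <;> cases c <;> simp_all
    exact .single (adjVia_iff_endOf.2 ⟨f, hfg, b, rfl, rfl⟩)

theorem isGateway_compEdges (g : E) (u : V) :
    IsGateway inc (compEdges inc g u)ᶜ (compEdges inc g u) g := by
  intro p hne hA hB
  by_contra hg
  have key : ∀ k i (hi : i < p.edges.length), i + k + 1 = p.edges.length →
      p.edges[i] ∈ compEdges inc g u := by
    intro k
    induction k with
    | zero =>
      intro i hi hik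
      rw [List.getLast_eq_getElem] at hB
      convert hB using 2
      omega
    | succ k ih =>
      intro i hi hik
      have hlen := p.len_eq
      exact ⟨fun h => hg (h ▸ List.getElem_mem _), _, p.incid_left i (by omega),
        reachable_of_mem_compEdges (ih (i + 1) (by omega) (by omega))
          (p.incid_right i (by omega))⟩
  have hpos := List.length_pos_iff.2 hne
  rw [List.head_eq_getElem] at hA
  exact hA (key (p.edges.length - 1) 0 hpos (by omega))

end Graph

section Extraction

variable {V E P : Type} [Fintype E] {inc : E → V × V} {edgeOf : P → E}

/-- If `e₀` knows that `δ` holds somewhere in `T`, then `δ` holds at an edge of `T` outside the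
given components, or the gateway to one of these components knows that `δ` holds behind it. -/
theorem exists_mem_or_box_mem {d : E → Form E P} (hd : ∀ e, InLang edgeOf {e} (d e))
    {M : Set (Form E P)} (hM : MaxConsistent inc edgeOf M) (e₀ : E) (T : Set E)
    (J : List (E × V))
    (hJ₀ : ∀ i ∈ J, e₀ ∉ compEdges inc i.1 i.2)
    (hJ : ∀ i ∈ J, ∀ j ∈ J, j.1 ∉ compEdges inc i.1 i.2)
    (hT : Form.box e₀ (disjSet d T) ∈ M) :
    (∃ t ∈ T, (∀ i ∈ J, t ∉ compEdges inc i.1 i.2) ∧ d t ∈ M) ∨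
      ∃ i ∈ J, Form.box i.1 (disjSet d (compEdges inc i.1 i.2)) ∈ M := by
  classical
  let rest : List (E × V) → List (Form E P) := fun J =>
    (Finset.univ.filter fun t => t ∈ T ∧ ∀ i ∈ J, t ∉ compEdges inc i.1 i.2).toList.map d
  let boxes : List (E × V) → List (Form E P) := fun J =>
    J.map fun i => Form.box i.1 (disjSet d (compEdges inc i.1 i.2))
  have mem_rest : ∀ J φ, φ ∈ rest J ↔
      ∃ t, (t ∈ T ∧ ∀ i ∈ J, t ∉ compEdges inc i.1 i.2) ∧ d t = φ := by
    intro J φ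
    simp [rest]
  have key : Form.box e₀ (bigDisj (rest J ++ boxes J)) ∈ M := by
    induction J with
    | nil =>
      refine hM.mem_of_deriv_imp (.box_mono e₀ (.taut fun v => ?_)) hT
      simp only [evalWith, evalWith_disjSet, evalWith_bigDisj]
      rintro ⟨t, ht, h⟩
      exact ⟨d t, by simp [boxes, mem_rest]; exact ⟨t, ht, rfl⟩, h⟩
    | cons i J ih =>
      have ih := ih (fun j hj => hJ₀ j (by simp [hj]))
        (fun j hj k hk => hJ j (by simp [hj]) k (by simp [hk]))
      refine hM.mem_of_deriv_imp ?_ ih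
      refine (Deriv.posIntro e₀ _).trans (.box_mono e₀ ?_)
      let A := bigDisj (rest (i :: J) ++ boxes J)
      have hA : InLang edgeOf (compEdges inc i.1 i.2)ᶜ A := by
        refine inLang_bigDisj fun φ hφ => ?_
        rcases List.mem_append.1 hφ with hφ | hφ
        · obtain ⟨t, ⟨-, ht⟩, rfl⟩ := (mem_rest _ _).1 hφ
          exact (hd t).mono (by simpa using ht i (by simp))
        · obtain ⟨j, hj, rfl⟩ := List.mem_map.1 hφ
          exact .box _ _ (hJ i (by simp) j (by simp [hj]))
      have step : Deriv inc edgeOf ((bigDisj (rest J ++ boxes J)).imp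
          (A.neg.imp (disjSet d (compEdges inc i.1 i.2)))) := by
        refine .taut fun v => ?_
        simp only [evalWith, evalWith_neg, evalWith_disjSet, evalWith_bigDisj, A]
        rintro ⟨φ, hφ, hv⟩ hA
        by_contra hC
        refine hA ⟨φ, ?_, hv⟩
        rcases List.mem_append.1 hφ with hφ | hφ
        · obtain ⟨t, ⟨htT, ht⟩, rfl⟩ := (mem_rest _ _).1 hφ
          refine List.mem_append_left _ ((mem_rest _ _).2 ⟨t, ⟨htT, ?_⟩, rfl⟩)
          simp only [List.mem_cons, forall_eq_or_imp]
          exact ⟨fun h => hC ⟨t, h, hv⟩, ht⟩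
        · exact List.mem_append_right _ hφ
      refine ((Deriv.box_mono e₀ step).trans
        (.gateway (isGateway_compEdges i.1 i.2) (hJ₀ i (by simp))
          (.imp hA .bot) (inLang_disjSet hd _))).trans (.taut fun v => ?_)
      simp only [evalWith, evalWith_neg, evalWith_bigDisj, A]
      intro h
      by_cases hA : ∃ φ ∈ rest (i :: J) ++ boxes J, evalWith v φ
      · obtain ⟨φ, hφ, hv⟩ := hA
        refine ⟨φ, ?_, hv⟩
        simp only [List.mem_append, boxes, List.map_cons, List.mem_cons] at hφ ⊢
        tauto
      · exact ⟨Form.box i.1 (disjSet d (compEdges inc i.1 i.2)), by simp [boxes], h hA⟩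
  obtain ⟨φ, hφ, hφM⟩ := hM.exists_mem_of_bigDisj (hM.mem_of_deriv_imp (.truth e₀ _) key)
  rcases List.mem_append.1 hφ with hφ | hφ
  · obtain ⟨t, ⟨htT, ht⟩, rfl⟩ := (mem_rest _ _).1 hφ
    exact .inl ⟨t, htT, ht, hφM⟩
  · obtain ⟨j, hj, rfl⟩ := List.mem_map.1 hφ
    exact .inr ⟨j, hj, hφM⟩

end Extraction

section Supply

variable {V E P : Type} [Fintype E] {inc : E → V × V} {edgeOf : P → E}

/-- Edge `e` knows that `δ` holds in the component at its end `b`. -/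
def KnowsBehind (inc : E → V × V) (d : E → Form E P) (M : Set (Form E P)) (e : E) (b : Bool) :
    Prop :=
  Form.box e (disjSet d (compEdges inc e (endOf inc e b))) ∈ M

theorem false_of_cut (hconn : ConnectedGraph inc) {d : E → Form E P}
    (hd : ∀ e, InLang edgeOf {e} (d e)) {M : Set (Form E P)} (hM : MaxConsistent inc edgeOf M)
    {S : Set V} (hS : ∀ e b, d e ∈ M → endOf inc e b ∈ S) {e₀ : E} {b₀ : Bool}
    (hde₀ : d e₀ ∉ M) (hu : endOf inc e₀ b₀ ∉ S)
    (hcross : ∀ e b, e ≠ e₀ → endOf inc e b ∈ S → endOf inc e (!b) ∉ S →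
      IsBridge inc e ∧ ¬ KnowsBehind inc d M e b)
    {T : Set E} (hT : T ⊆ insert e₀ (compEdges inc e₀ (endOf inc e₀ b₀)))
    (hbox : Form.box e₀ (disjSet d T) ∈ M) : False := by
  classical
  set u := endOf inc e₀ b₀ with hu_def
  let K : V → Prop := Relation.ReflTransGen (fun x y => AdjVia inc {x | x ≠ e₀} x y ∧ y ∉ S) u
  have hKS : ∀ x, K x → x ∉ S := by
    intro x hx
    cases hx with
    | refl => exact hu
    | tail _ h => exact h.2
  have hKreach : ∀ e b, endOf inc e b ∈ S → ∀ x, K x → ReachableVia inc {y | y ≠ e} u x := by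
    intro e b heS x hx
    induction hx with
    | refl => exact .refl
    | @tail y z hy hyz ih =>
      obtain ⟨s, -, c, rfl, rfl⟩ := adjVia_iff_endOf.1 hyz.1
      refine ih.tail (adjVia_iff_endOf.2 ⟨s, ?_, c, rfl, rfl⟩)
      rintro rfl
      by_cases hbc : b = c
      · exact hKS _ hy (hbc ▸ heS)
      · obtain rfl : b = !c := by cases b <;> cases c <;> simp_all
        exact hyz.2 heS
  have hnot : ∀ e b, e ≠ e₀ → endOf inc e b ∈ S → K (endOf inc e (!b)) →
      ∀ t z, Incident inc t z → K z → t ∉ compEdges inc e (endOf inc e b) := by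
    intro e b he heS heK t z htz hz ht
    have h := (reachable_of_mem_compEdges ht htz).trans
      (((hKreach e b heS z hz).symm).trans (hKreach e b heS _ heK))
    exact not_isBridge_of_reachable hconn b h (hcross e b he heS (hKS _ heK)).1
  let J : List (E × V) :=
    ((Finset.univ.filter fun p : E × Bool =>
      p.1 ≠ e₀ ∧ endOf inc p.1 p.2 ∈ S ∧ K (endOf inc p.1 (!p.2))).toList).map
        fun p => (p.1, endOf inc p.1 p.2)
  have hJ : ∀ i, i ∈ J ↔ ∃ e b, (e ≠ e₀ ∧ endOf inc e b ∈ S ∧ K (endOf inc e (!b))) ∧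
      (e, endOf inc e b) = i := by
    intro i
    simp [J]
  have hcover : ∀ x, ReachableVia inc {y | y ≠ e₀} u x →
      K x ∨ ∃ i ∈ J, ReachableVia inc {y | y ≠ i.1} i.2 x := by
    intro x hx
    induction hx with
    | refl => exact .inl .refl
    | @tail x y _ hxy ih =>
      obtain ⟨s, hs, c, rfl, rfl⟩ := adjVia_iff_endOf.1 hxy
      by_cases hy : K (endOf inc s (!c))
      · exact .inl hy
      refine .inr ?_
      by_cases hx : K (endOf inc s c)
      · have hyS : endOf inc s (!c) ∈ S := by
          by_contra h
          exact hy (hx.tail ⟨hxy, h⟩)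
        exact ⟨_, (hJ _).2 ⟨s, !c, ⟨hs, hyS, by simpa using hx⟩, rfl⟩, .refl⟩
      · obtain ⟨i, hi, hreach⟩ := ih.resolve_left hx
        refine ⟨i, hi, ?_⟩
        obtain ⟨e, b, ⟨he, heS, heK⟩, rfl⟩ := (hJ _).1 hi
        by_cases hse : s = e
        · subst hse
          by_cases hbc : b = c
          · exact (hy (hbc ▸ heK)).elim
          · obtain rfl : b = !c := by cases b <;> cases c <;> simp_all
            exact .refl
        · exact hreach.tail (adjVia_iff_endOf.2 ⟨s, hse, c, rfl, rfl⟩)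
  have hJ₀ : ∀ i ∈ J, e₀ ∉ compEdges inc i.1 i.2 := by
    intro i hi
    obtain ⟨e, b, ⟨he, heS, heK⟩, rfl⟩ := (hJ _).1 hi
    exact hnot e b he heS heK e₀ u (incident_endOf _ _) .refl
  have hJJ : ∀ i ∈ J, ∀ j ∈ J, j.1 ∉ compEdges inc i.1 i.2 := by
    intro i hi j hj
    obtain ⟨e, b, ⟨he, heS, heK⟩, rfl⟩ := (hJ _).1 hi
    obtain ⟨e', b', ⟨he', heS', heK'⟩, rfl⟩ := (hJ _).1 hj
    exact hnot e b he heS heK e' _ (incident_endOf _ _) heK'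
  rcases exists_mem_or_box_mem hd hM e₀ T J hJ₀ hJJ hbox with ⟨t, htT, ht, hdt⟩ | ⟨i, hi, h⟩
  · have hte₀ : t ≠ e₀ := fun h => hde₀ (h ▸ hdt)
    obtain ⟨-, w, htw, hw⟩ := (hT htT).resolve_left hte₀
    obtain ⟨c, rfl⟩ := incident_iff_endOf.1 htw
    rcases hcover _ hw with hwK | ⟨i, hi, hreach⟩
    · exact hKS _ hwK (hS t c hdt)
    · refine ht i hi ⟨?_, _, htw, hreach⟩
      obtain ⟨e, b, ⟨he, heS, heK⟩, rfl⟩ := (hJ _).1 hi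
      rintro rfl
      exact hKS _ heK (hS _ _ hdt)
  · obtain ⟨e, b, ⟨he, heS, heK⟩, rfl⟩ := (hJ _).1 hi
    exact (hcross e b he heS (hKS _ heK)).2 h

/-- Flow may leave the end `b` of `e` through `e`. At `h`, if the end `b₀` is allowed as the
origin of a flow through a bridge, then the opposite direction is not. -/
def Permits (inc : E → V × V) (d : E → Form E P) (M : Set (Form E P)) (h : E) (b₀ : Bool)
    (e : E) (b : Bool) : Prop :=
  d e ∉ M ∧ (IsBridge inc e → KnowsBehind inc d M e b) ∧
    ¬ (e = h ∧ b = (!b₀) ∧ IsBridge inc h ∧ KnowsBehind inc d M h b₀)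

/-- `v` can be supplied from an edge where `δ` holds by a permitted walk of length `n`. -/
inductive Supplied (inc : E → V × V) (d : E → Form E P) (M : Set (Form E P)) (h : E) (b₀ : Bool) :
    ℕ → V → Prop
  | source (e : E) (b : Bool) : d e ∈ M → Supplied inc d M h b₀ 0 (endOf inc e b)
  | step (n : ℕ) (e : E) (b : Bool) : Permits inc d M h b₀ e b →
      Supplied inc d M h b₀ n (endOf inc e b) → Supplied inc d M h b₀ (n + 1) (endOf inc e (!b))

theorem isBridge_and_not_knowsBehind_of_cross {d : E → Form E P} {M : Set (Form E P)} {h : E}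
    {b₀ : Bool} {e : E} {b : Bool}
    (hex : ¬ (e = h ∧ b = (!b₀) ∧ IsBridge inc h ∧ KnowsBehind inc d M h b₀))
    (hb : ∃ n, Supplied inc d M h b₀ n (endOf inc e b))
    (hb' : ¬ ∃ n, Supplied inc d M h b₀ n (endOf inc e (!b))) :
    IsBridge inc e ∧ ¬ KnowsBehind inc d M e b := by
  by_contra hcon
  obtain ⟨n, hn⟩ := hb
  by_cases he : d e ∈ M
  · exact hb' ⟨0, .source e _ he⟩
  · refine hb' ⟨n + 1, .step n e b ⟨he, fun hbr => ?_, hex⟩ hn⟩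
    by_contra hk
    exact hcon ⟨hbr, hk⟩

theorem exists_knowsBehind (hconn : ConnectedGraph inc) {d : E → Form E P}
    (hd : ∀ e, InLang edgeOf {e} (d e)) {M : Set (Form E P)} (hM : MaxConsistent inc edgeOf M)
    {e : E} (he : d e ∉ M) (hbox : Form.box e (deltaForm d) ∈ M) : ∃ b, KnowsBehind inc d M e b := by
  rw [← disjSet_univ] at hbox
  rcases exists_mem_or_box_mem hd hM e Set.univ
    [(e, endOf inc e true), (e, endOf inc e false)] (by simp [compEdges]) (by simp [compEdges])
    hbox with ⟨t, -, ht, hdt⟩ | ⟨i, hi, h⟩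
  · exfalso
    obtain ⟨b, hb⟩ := reachable_end_of_isBridge hconn e (endOf inc t true)
    have hte : t ≠ e := fun h => he (h ▸ hdt)
    refine ht (e, endOf inc e b) (by cases b <;> simp) ⟨hte, _, incident_endOf t true, hb⟩
  · simp only [List.mem_cons, List.not_mem_nil, or_false] at hi
    rcases hi with rfl | rfl
    · exact ⟨true, h⟩
    · exact ⟨false, h⟩

theorem supplied_of_bridge (hconn : ConnectedGraph inc) {d : E → Form E P}
    (hd : ∀ e, InLang edgeOf {e} (d e)) {M : Set (Form E P)} (hM : MaxConsistent inc edgeOf M)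
    (h : E) (b₀ : Bool) {e : E} {b : Bool} (hbr : IsBridge inc e)
    (hp : Permits inc d M h b₀ e b) : ∃ n, Supplied inc d M h b₀ n (endOf inc e b) := by
  have hh : ∀ (hdh : d h ∉ M) (hk : KnowsBehind inc d M h b₀),
      ∃ n, Supplied inc d M h b₀ n (endOf inc h b₀) := by
    intro hdh hk
    by_contra hcon
    refine false_of_cut hconn hd hM (S := {v | ∃ n, Supplied inc d M h b₀ n v})
      (fun e b he => ⟨0, .source e b he⟩) hdh hcon ?_ (Set.subset_insert _ _) hk
    exact fun e b he hS hS' =>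
      isBridge_and_not_knowsBehind_of_cross (fun hex => he hex.1) hS hS'
  by_contra hcon
  refine false_of_cut hconn hd hM (S := {v | ∃ n, Supplied inc d M h b₀ n v})
    (fun e b he => ⟨0, .source e b he⟩) hp.1 hcon ?_ (Set.subset_insert _ _) (hp.2.1 hbr)
  refine fun e b he hS hS' => isBridge_and_not_knowsBehind_of_cross ?_ hS hS'
  rintro ⟨rfl, rfl, -, hk⟩
  rw [Bool.not_not] at hS'
  by_cases hde : d e ∈ M
  · exact hS' ⟨0, .source e _ hde⟩
  · exact hS' (hh hde hk)

theorem supplied_of_not_bridge (hconn : ConnectedGraph inc) {d : E → Form E P}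
    (hd : ∀ e, InLang edgeOf {e} (d e)) {M : Set (Form E P)} (hM : MaxConsistent inc edgeOf M)
    (h : E) (b₀ : Bool) {e : E} (hbr : ¬ IsBridge inc e) (hde : d e ∉ M)
    (hbox : Form.box e (deltaForm d) ∈ M) (b : Bool) :
    ∃ n, Supplied inc d M h b₀ n (endOf inc e b) := by
  by_contra hcon
  rw [← disjSet_univ] at hbox
  refine false_of_cut hconn hd hM (S := {v | ∃ n, Supplied inc d M h b₀ n v})
    (fun e b he => ⟨0, .source e b he⟩) hde hcon ?_ ?_ hbox
  · refine fun e b he hS hS' => isBridge_and_not_knowsBehind_of_cross ?_ hS hS'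
    rintro ⟨rfl, rfl, hbre, hk⟩
    rw [Bool.not_not] at hS'
    by_cases hde : d e ∈ M
    · exact hS' ⟨0, .source e _ hde⟩
    · exact hS' (supplied_of_bridge hconn hd hM e b₀ hbre ⟨hde, fun _ => hk, by simp⟩)
  · intro t _
    by_cases ht : t = e
    · exact .inl ht
    · exact .inr ⟨ht, _, incident_endOf t true, not_not.1 hbr _ _⟩

end Supply

section Flow

open Classical in
/-- The unit flow through the edge `s` from its end `c` to its other end. -/
noncomputable def dartFlow {E : Type} (s : E) (c : Bool) : E → Bool → ℝ :=
  fun e b => if e = s then (if b = c then -1 else 1) else 0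

theorem dartFlow_add_eq_zero {E : Type} (s : E) (c : Bool) (e : E) :
    dartFlow s c e true + dartFlow s c e false = 0 := by
  by_cases h : e = s <;> cases c <;> simp [dartFlow, h]

variable {V E P : Type} [Fintype E] {inc : E → V × V} {edgeOf : P → E}

/-- The total of a flow on edge ends, weighted by a function on the vertices. -/
def weightedFlow (inc : E → V × V) (f : E → Bool → ℝ) (χ : V → ℝ) : ℝ :=
  ∑ e, ∑ b, f e b * χ (endOf inc e b)

theorem weightedFlow_add (f g : E → Bool → ℝ) (χ : V → ℝ) :
    weightedFlow inc (f + g) χ = weightedFlow inc f χ + weightedFlow inc g χ := by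
  simp only [weightedFlow, Pi.add_apply, add_mul, Finset.sum_add_distrib]

theorem weightedFlow_smul (c : ℝ) (f : E → Bool → ℝ) (χ : V → ℝ) :
    weightedFlow inc (c • f) χ = c * weightedFlow inc f χ := by
  simp [weightedFlow, Finset.mul_sum, mul_add, mul_assoc]

theorem weightedFlow_dartFlow (s : E) (c : Bool) (χ : V → ℝ) :
    weightedFlow inc (dartFlow s c) χ = χ (endOf inc s (!c)) - χ (endOf inc s c) := by
  classical
  rw [weightedFlow, Finset.sum_eq_single s]
  · cases c <;> simp [dartFlow] <;> ring
  · intro e _ he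
    simp [dartFlow, he]
  · simp

theorem exists_flow_of_reachable {h : E} {x y : V} (hxy : ReachableVia inc {e | e ≠ h} x y) :
    ∃ g : E → Bool → ℝ, (∀ e, g e true + g e false = 0) ∧ (∀ b, g h b = 0) ∧
      ∀ χ, weightedFlow inc g χ = χ y - χ x := by
  induction hxy with
  | refl => exact ⟨0, by simp, by simp, by simp [weightedFlow]⟩
  | @tail y z _ hyz ih =>
    obtain ⟨g, hg, hgh, hgχ⟩ := ih
    obtain ⟨s, hs, c, rfl, rfl⟩ := adjVia_iff_endOf.1 hyz
    refine ⟨g + dartFlow s c, fun e => ?_, fun b => ?_, fun χ => ?_⟩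
    · have h₁ := hg e
      have h₂ := dartFlow_add_eq_zero s c e
      simp only [Pi.add_apply]
      linarith
    · have : h ≠ s := fun h => hs h.symm
      simp [hgh, dartFlow, this]
    · rw [weightedFlow_add, hgχ, weightedFlow_dartFlow]
      ring

theorem eq_zero_of_circulation (hconn : ConnectedGraph inc) {g : E → Bool → ℝ}
    (hg : ∀ e, g e true + g e false = 0) (hgχ : ∀ χ : V → ℝ, weightedFlow inc g χ = 0) {e : E}
    (he : IsBridge inc e) (b : Bool) : g e b = 0 := by
  classical
  let C : Set V := {v | ReachableVia inc {x | x ≠ e} (endOf inc e true) v}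
  have h₁ : endOf inc e true ∈ C := .refl
  have h₂ : endOf inc e false ∉ C := fun h => not_isBridge_of_reachable hconn true h he
  have h := hgχ (C.indicator 1)
  rw [weightedFlow, Finset.sum_eq_single e] at h
  · have := hg e
    simp [h₁, h₂] at h
    cases b <;> linarith
  · intro s _ hs
    have adj : ∀ c, endOf inc s c ∈ C → endOf inc s (!c) ∈ C := fun c hc =>
      Relation.ReflTransGen.tail hc (adjVia_iff_endOf.2 ⟨s, hs, c, rfl, rfl⟩)
    have hiff : endOf inc s true ∈ C ↔ endOf inc s false ∈ C := ⟨adj true, adj false⟩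
    have := hg s
    by_cases hc : endOf inc s false ∈ C <;> simp [hiff, hc, this]
  · simp

theorem exists_circulation (hconn : ConnectedGraph inc) {h : E} (hh : ¬ IsBridge inc h) :
    ∃ g : E → Bool → ℝ, (∀ e, g e true + g e false = 0) ∧ (∀ χ, weightedFlow inc g χ = 0) ∧
      (∀ e, IsBridge inc e → ∀ b, g e b = 0) ∧ g h true = 1 := by
  obtain ⟨g, hg, hgh, hgχ⟩ := exists_flow_of_reachable
    (not_not.1 hh (endOf inc h true) (endOf inc h false))
  have h₁ : ∀ e, (g + dartFlow h false) e true + (g + dartFlow h false) e false = 0 := by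
    intro e
    have h₁ := hg e
    have h₂ := dartFlow_add_eq_zero h false e
    simp only [Pi.add_apply]
    linarith
  have h₂ : ∀ χ, weightedFlow inc (g + dartFlow h false) χ = 0 := by
    intro χ
    rw [weightedFlow_add, hgχ, weightedFlow_dartFlow]
    simp
  exact ⟨_, h₁, h₂, fun e he b => eq_zero_of_circulation hconn h₁ h₂ he b,
    by simp [hgh, dartFlow]⟩

/-- The conditions on the flow values of an edge under the canonical protocol `𝒫^δ_E`, with
membership in the set of the edge replaced by membership in `M`. -/
structure GoodValue (inc : E → V × V) (d : E → Form E P) (M : Set (Form E P)) (e : E)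
    (g : Bool → ℝ) : Prop where
  pos_iff : 0 < g true + g false ↔ d e ∈ M
  sum_eq_zero : IsBridge inc e → d e ∉ M → g true + g false = 0
  knowsBehind : IsBridge inc e → ∀ b, g b < 0 → KnowsBehind inc d M e b
  exists_neg : IsBridge inc e → Form.box e (deltaForm d) ∈ M → d e ∉ M → ∃ b, g b < 0
  box_mem : ¬ IsBridge inc e → g true + g false < 0 → Form.box e (deltaForm d) ∈ M
  sum_neg : ¬ IsBridge inc e → Form.box e (deltaForm d) ∈ M → d e ∉ M → g true + g false < 0

theorem isCanValue_iff_goodValue {d : E → Form E P} (hd : ∀ e, InLang edgeOf {e} (d e))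
    {M : Set (Form E P)} (hM : MaxConsistent inc edgeOf M) (e : E) (g : Bool → ℝ) :
    IsCanValue inc edgeOf d Set.univ e ⟨M ∩ {φ | InLang edgeOf {e} φ}, g true, g false⟩ ↔
      GoodValue inc d M e g := by
  have hbox : ∀ φ : Form E P, InLang edgeOf {e} (Form.box e φ) := fun φ => .box e φ rfl
  have hX := hM.inter_inLang {e}
  simp only [IsCanValue, Set.mem_inter_iff, Set.mem_ofPred_eq, hd e, hbox, and_true, gt_iff_lt, hX,
    true_and, Set.mem_univ, true_imp_iff]
  constructor
  · rintro ⟨h₁, h₂, h₃, h₄, h₅, h₆, h₇⟩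
    refine ⟨h₁, h₂, fun hb b => ?_, fun hb hk hde => ?_, h₆, h₇⟩
    · cases b
      exacts [h₄ hb, h₃ hb]
    · rcases h₅ hb hk hde with h | h
      exacts [⟨_, h⟩, ⟨_, h⟩]
  · rintro ⟨h₁, h₂, h₃, h₅, h₆, h₇⟩
    refine ⟨h₁, h₂, fun hb => h₃ hb true, fun hb => h₃ hb false, fun hb hk hde => ?_, h₆, h₇⟩
    obtain ⟨b, h⟩ := h₅ hb hk hde
    cases b
    exacts [.inr h, .inl h]

theorem GoodValue.smul {d : E → Form E P} {M : Set (Form E P)} {e : E} {g : Bool → ℝ}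
    (hg : GoodValue inc d M e g) {c : ℝ} (hc : 0 < c) : GoodValue inc d M e (c • g) := by
  have hneg : ∀ x : ℝ, c * x < 0 ↔ x < 0 := fun x => by
    rw [← neg_pos, ← mul_neg, mul_pos_iff_of_pos_left hc, neg_pos]
  constructor <;> simp only [Pi.smul_apply, smul_eq_mul, ← mul_add, hneg, mul_pos_iff_of_pos_left hc]
  · exact hg.pos_iff
  · intro h₁ h₂
    rw [hg.sum_eq_zero h₁ h₂, mul_zero]
  · exact hg.knowsBehind
  · exact hg.exists_neg
  · exact hg.box_mem
  · exact hg.sum_neg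

theorem GoodValue.of_sum_eq {d : E → Form E P} {M : Set (Form E P)} {e : E} {g g' : Bool → ℝ}
    (hg : GoodValue inc d M e g) (hsum : g' true + g' false = g true + g false)
    (hbr : IsBridge inc e → g' = g) : GoodValue inc d M e g' := by
  by_cases hb : IsBridge inc e
  · rwa [hbr hb]
  · constructor <;> simp only [hsum, hb, not_false_eq_true, true_imp_iff, IsEmpty.forall_iff]
    · exact hg.pos_iff
    · exact hg.box_mem hb
    · exact hg.sum_neg hb

theorem knowsBehind_imp_box_mem {d : E → Form E P} {M : Set (Form E P)}
    (hM : MaxConsistent inc edgeOf M) {e : E} {b : Bool} (h : KnowsBehind inc d M e b) :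
    Form.box e (deltaForm d) ∈ M := by
  rw [← disjSet_univ]
  exact hM.mem_of_deriv_imp (.box_disjSet_mono d e (Set.subset_univ _)) h

/-- A flow of `y` through `e` from its end `b`, where a further `x` is absorbed. -/
theorem goodValue_of_directed {d : E → Form E P} {M : Set (Form E P)} {e : E} (hde : d e ∉ M)
    (b : Bool) {x y : ℝ} (hx : 0 ≤ x) (hy : 0 ≤ y) (hbx : IsBridge inc e → x = 0)
    (hbk : IsBridge inc e → 0 < y → KnowsBehind inc d M e b)
    (hby : IsBridge inc e → Form.box e (deltaForm d) ∈ M → 0 < y)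
    (hnb : ¬ IsBridge inc e → (0 < x ↔ Form.box e (deltaForm d) ∈ M)) :
    GoodValue inc d M e (fun c => if c = b then -y - x else y) := by
  have hsum : (if true = b then -y - x else y) + (if false = b then -y - x else y) = -x := by
    cases b <;> simp <;> ring
  constructor <;> try simp only [hsum]
  · exact ⟨fun h => by linarith, fun h => (hde h).elim⟩
  · exact fun hb _ => by rw [hbx hb, neg_zero]
  · intro hb c hc
    split_ifs at hc with hcb
    · rw [hbx hb] at hc
      exact hcb ▸ hbk hb (by linarith)
    · linarith
  · intro hb hbox _
    refine ⟨b, ?_⟩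
    have := hby hb hbox
    simp only [if_true]
    linarith
  · exact fun hb h => (hnb hb).1 (by linarith)
  · intro hb hbox _
    have := (hnb hb).2 hbox
    linarith

end Flow

section Balance

variable {V E P : Type} [Fintype E] {inc : E → V × V} {edgeOf : P → E}

theorem exists_parent {d : E → Form E P} {M : Set (Form E P)} {h : E} {b₀ : Bool} :
    ∃ k : V → ℕ, ∀ v, (∃ n, Supplied inc d M h b₀ n v) → (∀ e, Incident inc e v → d e ∉ M) →
      ∃ e b, Permits inc d M h b₀ e b ∧ endOf inc e (!b) = v ∧
        (∃ n, Supplied inc d M h b₀ n (endOf inc e b)) ∧ k (endOf inc e b) < k v := by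
  classical
  refine ⟨fun v => if hv : ∃ n, Supplied inc d M h b₀ n v then Nat.find hv else 0, ?_⟩
  intro v hv hsrc
  simp only [dif_pos hv]
  have hspec := Nat.find_spec hv
  generalize Nat.find hv = n at hspec
  cases hspec with
  | source e b he => exact (hsrc e (incident_endOf e b) he).elim
  | step n e b hp hn =>
    refine ⟨e, b, hp, rfl, ⟨n, hn⟩, ?_⟩
    rw [dif_pos ⟨n, hn⟩]
    exact Nat.lt_succ_of_le (Nat.find_min' _ hn)

theorem exists_balanced_flow (hconn : ConnectedGraph inc) {d : E → Form E P}
    (hd : ∀ e, InLang edgeOf {e} (d e)) {M : Set (Form E P)} (hM : MaxConsistent inc edgeOf M)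
    (h : E) (b₀ : Bool) :
    ∃ f : E → Bool → ℝ, (∀ e, GoodValue inc d M e (f e)) ∧
      (∀ u, (∀ e, Incident inc e u → d e ∉ M) → 0 ≤ weightedFlow inc f (Set.indicator {u} 1)) ∧
      (IsBridge inc h → d h ∉ M → KnowsBehind inc d M h b₀ → f h b₀ < 0) := by
  classical
  let S : V → Prop := fun v => ∃ n, Supplied inc d M h b₀ n v
  let N : V → Prop := fun v => ∀ e, Incident inc e v → d e ∉ M
  obtain ⟨k, hk⟩ := exists_parent (inc := inc) (d := d) (M := M) (h := h) (b₀ := b₀)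
  have : Nonempty E := ⟨h⟩
  choose! pe pb hperm hend hsrc hlt using hk
  let a : ℝ := 1 / (4 * Fintype.card E + 1)
  have ha : 0 < a := by positivity
  have ha_mul : a * (4 * Fintype.card E + 1) = 1 := one_div_mul_cancel (by positivity)
  have ha₁ : a ≤ 1 := by
    have : (0 : ℝ) ≤ Fintype.card E := by positivity
    nlinarith
  let L : V → ℝ := fun v => a ^ k v
  have hL : ∀ v, 0 < L v := fun v => pow_pos ha _
  have hL_le : ∀ v w, k w < k v → L v ≤ a * L w := by
    intro v w hvw
    have : a ^ k v ≤ a ^ (k w + 1) := pow_le_pow_of_le_one ha.le ha₁ hvw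
    rw [pow_succ] at this
    linarith
  have hbound : ∀ e, ∃ g : Bool → ℝ, GoodValue inc d M e g ∧
      (∀ b, g b < 0 → S (endOf inc e b) ∧ -(2 * a * L (endOf inc e b)) ≤ g b) ∧
      (∀ v, S v → N v → pe v = e → L v ≤ g (!(pb v))) ∧
      (e = h → IsBridge inc h → d h ∉ M → KnowsBehind inc d M h b₀ → g b₀ < 0) := by
    intro e
    by_cases hde : d e ∈ M
    · refine ⟨fun _ => 1, ?_, fun b hb => by norm_num at hb, ?_, fun heh _ hdh => ?_⟩
      · constructor <;> norm_num [hde]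
      · rintro v hv hNv rfl
        exact ((hperm v hv hNv).1 hde).elim
      · exact (hdh (heh ▸ hde)).elim
    by_cases hpar : ∃ v, S v ∧ N v ∧ pe v = e
    · obtain ⟨v, hv, hNv, rfl⟩ := hpar
      let x : ℝ := if ¬ IsBridge inc (pe v) ∧ Form.box (pe v) (deltaForm d) ∈ M then
        a * L (endOf inc (pe v) (pb v)) else 0
      have hx : 0 ≤ x := by
        dsimp only [x]
        split_ifs
        exacts [(mul_pos ha (hL _)).le, le_rfl]
      have hx_le : x ≤ a * L (endOf inc (pe v) (pb v)) := by
        dsimp only [x]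
        split_ifs
        exacts [le_rfl, (mul_pos ha (hL _)).le]
      have hv_lt := hlt v hv hNv
      have hp := hperm v hv hNv
      refine ⟨_, goodValue_of_directed hde (pb v) hx (hL v).le ?_ ?_ ?_ ?_, ?_, ?_, ?_⟩
      · exact fun hb => by simp [x, hb]
      · exact fun hb _ => hp.2.1 hb
      · exact fun _ _ => hL v
      · intro hb
        by_cases hbox : Form.box (pe v) (deltaForm d) ∈ M
        · simpa [x, hb, hbox] using mul_pos ha (hL _)
        · simp [x, hbox]
      · intro b hb
        split_ifs at hb ⊢ with hbv
        · subst hbv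
          refine ⟨hsrc v hv hNv, ?_⟩
          have := hL_le _ _ hv_lt
          linarith
        · exact (hb.not_gt (hL v)).elim
      · intro w hw hNw hwe
        by_cases hbw : pb w = pb v
        · obtain rfl : w = v := by rw [← hend w hw hNw, ← hend v hv hNv, hwe, hbw]
          simp
        · exfalso
          have hbw : pb w = !(pb v) := by
            revert hbw
            cases pb w <;> cases pb v <;> simp
          have h₁ := hlt w hw hNw
          have h₂ := hend w hw hNw
          have h₃ := hend v hv hNv
          rw [hwe, hbw] at h₁ h₂
          rw [Bool.not_not] at h₂
          rw [h₃, ← h₂] at h₁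
          omega
      · intro heh hb _ hkb
        have hbv : b₀ = pb v := by
          by_contra hne
          refine hp.2.2 ⟨heh, ?_, hb, hkb⟩
          revert hne
          cases pb v <;> cases b₀ <;> simp
        have := hL v
        simp only [hbv, if_true]
        linarith
    have hpar' : ∀ v, S v → N v → pe v = e → False := fun v h₁ h₂ h₃ => hpar ⟨v, h₁, h₂, h₃⟩
    by_cases hbox : Form.box e (deltaForm d) ∈ M
    swap
    · refine ⟨_, goodValue_of_directed hde true le_rfl le_rfl (fun _ => rfl)
        (fun _ h => (lt_irrefl _ h).elim) (fun _ h => (hbox h).elim) (fun _ => ?_),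
        fun b hb => by simp at hb, fun v h₁ h₂ h₃ => (hpar' v h₁ h₂ h₃).elim, ?_⟩
      · simp [hbox]
      · rintro rfl _ _ hkb
        exact (hbox (knowsBehind_imp_box_mem hM hkb)).elim
    by_cases hbr : IsBridge inc e
    · obtain ⟨b, hpb, hb₀⟩ : ∃ b, Permits inc d M h b₀ e b ∧
          (e = h → KnowsBehind inc d M h b₀ → b = b₀) := by
        by_cases heh : e = h ∧ KnowsBehind inc d M h b₀
        · obtain ⟨rfl, hkb⟩ := heh
          exact ⟨b₀, ⟨hde, fun _ => hkb, by simp⟩, fun _ _ => rfl⟩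
        · obtain ⟨b, hb⟩ := exists_knowsBehind hconn hd hM hde hbox
          exact ⟨b, ⟨hde, fun _ => hb, fun hex => heh ⟨hex.1, hex.2.2.2⟩⟩,
            fun h₁ h₂ => (heh ⟨h₁, h₂⟩).elim⟩
      have hpos := mul_pos ha (hL (endOf inc e b))
      refine ⟨_, goodValue_of_directed hde b le_rfl hpos.le (fun _ => rfl)
        (fun hb _ => hpb.2.1 hb) (fun _ _ => hpos) (fun hb => (hb hbr).elim), ?_,
        fun v h₁ h₂ h₃ => (hpar' v h₁ h₂ h₃).elim, ?_⟩
      · intro c hc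
        split_ifs at hc ⊢ with hcb
        · subst hcb
          exact ⟨supplied_of_bridge hconn hd hM h b₀ hbr hpb, by linarith⟩
        · exact (hc.not_gt hpos).elim
      · intro heh _ _ hkb
        obtain rfl := hb₀ heh hkb
        simp only [if_true]
        linarith
    · have hpos := mul_pos ha (hL (endOf inc e true))
      refine ⟨_, goodValue_of_directed hde true hpos.le le_rfl (fun hb => (hbr hb).elim)
        (fun hb => (hbr hb).elim) (fun hb => (hbr hb).elim) (fun _ => ?_), ?_,
        fun v h₁ h₂ h₃ => (hpar' v h₁ h₂ h₃).elim, ?_⟩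
      · simp only [hpos, hbox]
      · intro c hc
        split_ifs at hc ⊢ with hcb
        · subst hcb
          exact ⟨supplied_of_not_bridge hconn hd hM h b₀ hbr hde hbox true, by linarith⟩
        · exact (lt_irrefl _ hc).elim
      · rintro rfl hb
        exact (hbr hb).elim
  choose f hf hf_neg hf_par hf_h using hbound
  refine ⟨f, hf, fun u hu => ?_, fun hb hdh hkb => hf_h h rfl hb hdh hkb⟩
  by_cases hSu : S u
  · have term : ∀ e b, -(2 * a * L u) ≤ f e b * Set.indicator {u} 1 (endOf inc e b) := by
      intro e b
      have := mul_pos ha (hL u)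
      by_cases heu : endOf inc e b = u
      · by_cases hfe : f e b < 0
        · simpa [heu] using (hf_neg e b hfe).2
        · simp only [heu, Set.mem_singleton_iff, Set.indicator_of_mem, Pi.one_apply, mul_one]
          linarith
      · simp only [Set.mem_singleton_iff, heu, not_false_eq_true, Set.indicator_of_notMem, mul_zero]
        linarith
    have edge : ∀ e, (if e = pe u then L u else 0) - 4 * a * L u ≤
        ∑ b, f e b * Set.indicator {u} 1 (endOf inc e b) := by
      intro e
      rw [Fintype.sum_bool]
      split_ifs with he
      · subst he
        have h₁ := hf_par _ u hSu hu rfl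
        have h₂ := hend u hSu hu
        have h₃ := term (pe u) (pb u)
        have h₄ : L u ≤ f (pe u) (!(pb u)) * Set.indicator {u} 1 (endOf inc (pe u) (!(pb u))) := by
          simpa [h₂] using h₁
        have := mul_pos ha (hL u)
        cases hbu : pb u <;> rw [hbu] at h₃ h₄ <;> simp only [Bool.not_true, Bool.not_false] at h₄ <;>
          linarith
      · linarith [term e true, term e false]
    have total := Finset.sum_le_sum fun e (_ : e ∈ Finset.univ) => edge e
    refine le_trans ?_ total
    rw [Finset.sum_sub_distrib]
    simp only [Finset.sum_ite_eq', Finset.mem_univ, if_true, Finset.sum_const, Finset.card_univ,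
      nsmul_eq_mul]
    have : L u - Fintype.card E * (4 * a * L u) = L u * (1 - a * (4 * Fintype.card E)) := by ring
    rw [this]
    exact mul_nonneg (hL u).le (by linarith)
  · refine Finset.sum_nonneg fun e _ => Finset.sum_nonneg fun b _ => ?_
    by_cases heu : endOf inc e b = u
    · have : ¬ f e b < 0 := fun hfe => hSu (heu ▸ (hf_neg e b hfe).1)
      simpa [heu] using this
    · simp [heu]

/-- The flow can be balanced so that it takes any admissible value at a given edge. -/
theorem exists_balanced_flow_eq (hconn : ConnectedGraph inc) {d : E → Form E P}
    (hd : ∀ e, InLang edgeOf {e} (d e)) {M : Set (Form E P)} (hM : MaxConsistent inc edgeOf M)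
    (h : E) {g₀ : Bool → ℝ} (hg₀ : GoodValue inc d M h g₀) :
    ∃ f : E → Bool → ℝ, (∀ e, GoodValue inc d M e (f e)) ∧
      (∀ u, (∀ e, Incident inc e u → d e ∉ M) → 0 ≤ weightedFlow inc f (Set.indicator {u} 1)) ∧
      f h = g₀ := by
  classical
  obtain ⟨b₀, hb₀⟩ : ∃ b₀, ∀ b, g₀ b < 0 → d h ∉ M → IsBridge inc h → g₀ b₀ < 0 := by
    by_cases hneg : g₀ true < 0
    · exact ⟨true, fun _ _ _ _ => hneg⟩
    · exact ⟨false, fun b hb _ _ => by cases b; exacts [hb, (hneg hb).elim]⟩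
  obtain ⟨f, hf, hfu, hfh⟩ := exists_balanced_flow hconn hd hM h b₀
  by_cases hdh : d h ∈ M
  · refine ⟨Function.update f h g₀, fun e => ?_, fun u hu => ?_, by simp⟩
    · by_cases heh : e = h
      · subst heh
        simpa using hg₀
      · simpa [heh] using hf e
    · convert hfu u hu using 1
      refine Finset.sum_congr rfl fun e _ => Finset.sum_congr rfl fun b _ => ?_
      by_cases heh : e = h
      · subst heh
        have : endOf inc e b ≠ u := fun hb => hu e (hb ▸ incident_endOf e b) hdh
        simp [this]
      · simp [heh]
  have scaled : ∀ c : ℝ, 0 < c → (∀ e, GoodValue inc d M e ((c • f) e)) ∧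
      ∀ u, (∀ e, Incident inc e u → d e ∉ M) →
        0 ≤ weightedFlow inc (c • f) (Set.indicator {u} 1) := fun c hc =>
    ⟨fun e => (hf e).smul hc, fun u hu => by
      rw [weightedFlow_smul]
      exact mul_nonneg hc.le (hfu u hu)⟩
  by_cases hbr : IsBridge inc h
  · have hsum := (hf h).sum_eq_zero hbr hdh
    have hsum₀ := hg₀.sum_eq_zero hbr hdh
    by_cases hbox : Form.box h (deltaForm d) ∈ M
    · obtain ⟨b, hb⟩ := hg₀.exists_neg hbr hbox hdh
      have hneg₀ := hb₀ b hb hdh hbr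
      have hneg := hfh hbr hdh (hg₀.knowsBehind hbr b₀ hneg₀)
      obtain ⟨h₁, h₂⟩ := scaled (g₀ b₀ / f h b₀) (div_pos_of_neg_of_neg hneg₀ hneg)
      refine ⟨_, h₁, h₂, ?_⟩
      have key : g₀ b₀ / f h b₀ * f h b₀ = g₀ b₀ := div_mul_cancel₀ _ hneg.ne
      have hzero : g₀ b₀ / f h b₀ * (f h true + f h false) = 0 := by rw [hsum, mul_zero]
      funext c
      simp only [Pi.smul_apply, smul_eq_mul]
      cases b₀ <;> cases c <;> linarith
    · have nonneg : ∀ g : Bool → ℝ, GoodValue inc d M h g → ∀ b, 0 ≤ g b := fun g hg b => by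
        by_contra hb
        exact hbox (knowsBehind_imp_box_mem hM (hg.knowsBehind hbr b (not_le.1 hb)))
      refine ⟨f, hf, hfu, ?_⟩
      have h₁ := nonneg _ (hf h)
      have h₂ := nonneg _ hg₀
      funext c
      cases c <;> linarith [h₁ true, h₁ false, h₂ true, h₂ false]
  · obtain ⟨c, hc, hcs⟩ : ∃ c : ℝ, 0 < c ∧ c * (f h true + f h false) = g₀ true + g₀ false := by
      by_cases hbox : Form.box h (deltaForm d) ∈ M
      · have h₁ := (hf h).sum_neg hbr hbox hdh
        have h₂ := hg₀.sum_neg hbr hbox hdh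
        exact ⟨_, div_pos_of_neg_of_neg h₂ h₁, div_mul_cancel₀ _ h₁.ne⟩
      · have zero : ∀ g : Bool → ℝ, GoodValue inc d M h g → g true + g false = 0 := fun g hg =>
          le_antisymm (not_lt.1 fun hlt => hdh (hg.pos_iff.1 hlt))
            (not_lt.1 fun hlt => hbox (hg.box_mem hbr hlt))
        exact ⟨1, one_pos, by rw [zero _ (hf h), zero _ hg₀, mul_zero]⟩
    obtain ⟨h₁, h₂⟩ := scaled c hc
    obtain ⟨z, hz, hzχ, hzb, hzh⟩ := exists_circulation hconn hbr
    let t := g₀ true - c * f h true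
    refine ⟨c • f + t • z, fun e => (h₁ e).of_sum_eq ?_ fun he => ?_, fun u hu => ?_, ?_⟩
    · have : t * (z e true + z e false) = 0 := by rw [hz, mul_zero]
      simp only [Pi.add_apply, Pi.smul_apply, smul_eq_mul]
      linarith
    · funext b
      simp [hzb e he b]
    · rw [weightedFlow_add, weightedFlow_smul t, hzχ, mul_zero, add_zero]
      exact h₂ u hu
    · have hzf : z h false = -1 := by linarith [hz h]
      funext b
      simp only [Pi.add_apply, Pi.smul_apply, smul_eq_mul]
      cases b
      · rw [hzf]
        linarith
      · rw [hzh]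
        linarith

end Balance

/-- Canonical run modification: for each edge h, each run r of
𝒫^δ_E, and each maximal consistent set M ⊆ Φ(Σ) with X^h = M ∩ Φ(Σ,{h}), there
is a run r̂ of 𝒫^δ_E with X̂^e = M ∩ Φ(Σ,{e}) for each edge e and r̂ =_h r. -/
theorem canRun_modify {V E P : Type} [Fintype E] (inc : E → V × V) (edgeOf : P → E)
    (hconn : ConnectedGraph inc)
    (d : E → Form E P) (hd : ∀ e : E, InLang edgeOf {e} (d e))
    (h : E) (r : (e : E) → CanValue E P)
    (hr : IsCanRun inc edgeOf d Set.univ r)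
    (M : Set (Form E P)) (hM : MaxConsistent inc edgeOf M)
    (hXh : (r h).X = M ∩ {φ | InLang edgeOf {h} φ}) :
    ∃ rhat : (e : E) → CanValue E P, IsCanRun inc edgeOf d Set.univ rhat ∧
      (∀ e : E, (rhat e).X = M ∩ {φ | InLang edgeOf {e} φ}) ∧
      rhat h = r h := by
  let g₀ : Bool → ℝ := fun b => cond b (r h).f₁ (r h).f₂
  have hrh : r h = ⟨M ∩ {φ | InLang edgeOf {h} φ}, g₀ true, g₀ false⟩ := by
    rw [← hXh]
    rfl
  have hg₀ : GoodValue inc d M h g₀ :=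
    (isCanValue_iff_goodValue hd hM h g₀).1 (hrh ▸ hr.1 h)
  obtain ⟨f, hf, hfu, hfh⟩ := exists_balanced_flow_eq hconn hd hM h hg₀
  refine ⟨fun e => ⟨M ∩ {φ | InLang edgeOf {e} φ}, f e true, f e false⟩,
    ⟨fun e => (isCanValue_iff_goodValue hd hM e (f e)).2 (hf e), fun u hu => ?_⟩,
    fun _ => rfl, ?_⟩
  · refine (hfu u fun e he hde => hu e he ⟨hde, hd e⟩).trans_eq ?_
    refine Finset.sum_congr rfl fun e _ => ?_
    by_cases h₁ : (inc e).1 = u <;> by_cases h₂ : (inc e).2 = u <;>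
      simp [h₁, h₂, flowAt, endOf]
  · simp only [hfh, ← hrh]
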